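/- Let p ∈ ℂ[x] be nonzero, σ an anti-involution of 𝒟ᵃ_p preserving the principal ℤ-gradation, and σ₀ : 𝒟ᵃ → 𝒟ᵃ the unique map with σ(X·p(D)) = σ₀(X)·p(D). Then there exist c ∈ ℂ and scalars ε_k ∈ {1, −1} (k ∈ ℤ) such that σ₀(t^k f(D)) = ε_k·t^k·f(−D − k + c) for every k ∈ ℤ and every f ∈ ℂ[x]. In particular σ₀(t^k) = ε_k·t^k with ε_k = ±1 for every k. -/

import Mathlib

noncomputable section

/-- ℂ[t,t⁻¹] as a ℂ-vector space with basis {t^j}_{j∈ℤ}; t^j is `Finsupp.single j 1`. -/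
abbrev LaurentV : Type := ℤ →₀ ℂ

/-- The regular differential operator `t^k f(D)` (where D = t·d/dt), acting by
t^j ↦ f(j)·t^{j+k}. -/
def op (k : ℤ) (f : Polynomial ℂ) : Module.End ℂ LaurentV :=
  Finsupp.lsum ℂ fun j => f.eval (j : ℂ) • Finsupp.lsingle (j + k)

/-- The graded piece (𝒟ᵃ_p)_j = {t^j f(D) p(D) : f ∈ ℂ[x]}. -/
def Dgrade (p : Polynomial ℂ) (j : ℤ) : Submodule ℂ (Module.End ℂ LaurentV) :=
  Submodule.span ℂ {A | ∃ f : Polynomial ℂ, A = op j (f * p)}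

/-- 𝒟ᵃ_p = 𝒟ᵃ·p(D). -/
def Dp (p : Polynomial ℂ) : Submodule ℂ (Module.End ℂ LaurentV) :=
  Submodule.span ℂ {A | ∃ (k : ℤ) (f : Polynomial ℂ), A = op k (f * p)}

/-- σ is an anti-involution: it is ℂ-linear (built into the type), involutive, and
reverses products. -/
def IsAntiInvolutionOn (p : Polynomial ℂ) (σ : ↥(Dp p) →ₗ[ℂ] ↥(Dp p)) : Prop :=
  (∀ A : ↥(Dp p), σ (σ A) = A) ∧
  (∀ A B W : ↥(Dp p),
    (W : Module.End ℂ LaurentV) = (A : Module.End ℂ LaurentV) * (B : Module.End ℂ LaurentV) →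
    ((σ W : Module.End ℂ LaurentV)) = (σ B : Module.End ℂ LaurentV) * (σ A : Module.End ℂ LaurentV))

/-- σ preserves the principal ℤ-gradation. -/
def PreservesGrading (p : Polynomial ℂ) (σ : ↥(Dp p) →ₗ[ℂ] ↥(Dp p)) : Prop :=
  ∀ (j : ℤ) (A : ↥(Dp p)), (A : Module.End ℂ LaurentV) ∈ Dgrade p j →
    ((σ A : Module.End ℂ LaurentV)) ∈ Dgrade p j

/-- σ(t^k f(D) p(D)) = (-1)^{deg p}·e^k·t^k f(−D−k+c)p(D). -/
def SigmaFormula (p : Polynomial ℂ) (c e : ℂ) (σ : ↥(Dp p) →ₗ[ℂ] ↥(Dp p)) : Prop :=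
  ∀ (k : ℤ) (f : Polynomial ℂ) (A : ↥(Dp p)), (A : Module.End ℂ LaurentV) = op k (f * p) →
    ((σ A : Module.End ℂ LaurentV)) =
      ((-1 : ℂ) ^ p.natDegree * e ^ k) •
        op k ((f.comp (Polynomial.C (c - (k : ℂ)) - Polynomial.X)) * p)

/-- The graded piece (𝒟_p^±)_k = {d ∈ (𝒟_p)_k : σ_±(d) = −d}, as a set. -/
def DpmGradeSet (p : Polynomial ℂ) (c e : ℂ) (k : ℤ) : Set (Module.End ℂ LaurentV) :=
  {A | ∃ f : Polynomial ℂ, A = op k (f * p) ∧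
    ((-1 : ℂ) ^ p.natDegree * e ^ k) •
      op k ((f.comp (Polynomial.C (c - (k : ℂ)) - Polynomial.X)) * p) = -A}

/-- The graded piece (𝒟_p^±)_k, as a ℂ-subspace. -/
def DpmGrade (p : Polynomial ℂ) (c e : ℂ) (k : ℤ) : Submodule ℂ (Module.End ℂ LaurentV) :=
  Submodule.span ℂ (DpmGradeSet p c e k)

/-- V has finite codimension in W. -/
def FinCodimIn {M : Type*} [AddCommGroup M] [Module ℂ M] (V W : Submodule ℂ M) : Prop :=
  FiniteDimensional ℂ (↥W ⧸ Submodule.comap W.subtype V)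

open Polynomial

theorem op_single (k : ℤ) (f : ℂ[X]) (j : ℤ) (a : ℂ) :
    op k f (Finsupp.single j a) = Finsupp.single (j + k) (f.eval (j : ℂ) * a) := by
  simp [op]

theorem eq_of_forall_int_eval_eq {f g : ℂ[X]}
    (h : ∀ j : ℤ, f.eval (j : ℂ) = g.eval (j : ℂ)) : f = g := by
  refine eq_of_infinite_eval_eq f g ?_
  refine (Set.infinite_range_of_injective (Int.cast_injective (α := ℂ))).mono ?_
  rintro _ ⟨j, rfl⟩
  exact h j

theorem op_injective (k : ℤ) : Function.Injective (op k) := by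
  intro f g h
  refine eq_of_forall_int_eval_eq fun j => ?_
  have := congrArg (fun A : Module.End ℂ LaurentV => A (Finsupp.single j 1) (j + k)) h
  simpa [op_single] using this

theorem op_mul_op (k l : ℤ) (f g : ℂ[X]) :
    op k f * op l g = op (k + l) (f.comp (X + C (l : ℂ)) * g) := by
  refine Finsupp.lhom_ext fun j a => ?_
  simp only [Module.End.mul_apply, op_single, eval_mul, eval_comp, eval_add, eval_X, eval_C,
    Int.cast_add, mul_assoc]
  rw [add_assoc, add_comm l k]

theorem op_add (k : ℤ) (f g : ℂ[X]) : op k (f + g) = op k f + op k g := by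
  refine Finsupp.lhom_ext fun j a => ?_
  simp [op_single, add_mul]

theorem op_C_mul (k : ℤ) (z : ℂ) (f : ℂ[X]) : op k (C z * f) = z • op k f := by
  refine Finsupp.lhom_ext fun j a => ?_
  rw [LinearMap.smul_apply, op_single, op_single, Finsupp.smul_single, smul_eq_mul,
    eval_C_mul, mul_assoc]

theorem op_zero (k : ℤ) : op k 0 = 0 := by
  simpa using op_C_mul k 0 0

theorem op_mem_Dp (p : ℂ[X]) (k : ℤ) (f : ℂ[X]) : op k (f * p) ∈ Dp p :=
  Submodule.subset_span ⟨k, f, rfl⟩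

theorem exists_eq_op_of_mem_Dgrade {p : ℂ[X]} {k : ℤ} {A : Module.End ℂ LaurentV}
    (hA : A ∈ Dgrade p k) : ∃ f : ℂ[X], A = op k (f * p) := by
  induction hA using Submodule.span_induction with
  | mem A h => exact h
  | zero => exact ⟨0, by rw [zero_mul, op_zero]⟩
  | add A B _ _ hA hB =>
    obtain ⟨f, rfl⟩ := hA
    obtain ⟨g, rfl⟩ := hB
    exact ⟨f + g, by rw [add_mul, op_add]⟩
  | smul z A _ hA =>
    obtain ⟨f, rfl⟩ := hA
    exact ⟨C z * f, by rw [mul_assoc, op_C_mul]⟩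

theorem exists_polynomial_coeff_of_mem_Dp {p : ℂ[X]} {A : Module.End ℂ LaurentV}
    (hA : A ∈ Dp p) (k : ℤ) :
    ∃ f : ℂ[X], ∀ j : ℤ, A (Finsupp.single j 1) (j + k) = f.eval (j : ℂ) := by
  induction hA using Submodule.span_induction with
  | mem A h =>
    obtain ⟨l, f, rfl⟩ := h
    by_cases hl : l = k
    · exact ⟨f * p, fun j => by simp [op_single, hl]⟩
    · exact ⟨0, fun j => by simp [op_single, hl]⟩
  | zero => exact ⟨0, by simp⟩
  | add A B _ _ hA hB =>
    obtain ⟨f, hf⟩ := hA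
    obtain ⟨g, hg⟩ := hB
    exact ⟨f + g, fun j => by simp [hf, hg]⟩
  | smul z A _ hA =>
    obtain ⟨f, hf⟩ := hA
    exact ⟨C z * f, fun j => by simp [hf]⟩

/-- Right multiplication by `p(D)` is injective on the differential operators. -/
theorem eq_of_mul_op_zero_eq {p q : ℂ[X]} (hp : p ≠ 0) {A B : Module.End ℂ LaurentV}
    (hA : A ∈ Dp q) (hB : B ∈ Dp q) (h : A * op 0 p = B * op 0 p) : A = B := by
  refine Finsupp.lhom_ext fun j a => ?_
  have key : ∀ k : ℤ, A (Finsupp.single j 1) (j + k) = B (Finsupp.single j 1) (j + k) := by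
    intro k
    obtain ⟨f, hf⟩ := exists_polynomial_coeff_of_mem_Dp hA k
    obtain ⟨g, hg⟩ := exists_polynomial_coeff_of_mem_Dp hB k
    have hfg : p * f = p * g := eq_of_forall_int_eval_eq fun i => by
      have hi := congrArg
        (fun M : Module.End ℂ LaurentV => M (Finsupp.single i 1) (i + k)) h
      have hs : (Finsupp.single i (p.eval (i : ℂ)) : LaurentV)
          = p.eval (i : ℂ) • Finsupp.single i 1 := by simp
      simp only [Module.End.mul_apply, op_single, add_zero, mul_one] at hi
      rw [hs, map_smul, map_smul, Finsupp.smul_apply, Finsupp.smul_apply, hf, hg] at hi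
      simpa using hi
    rw [hf, hg, mul_left_cancel₀ hp hfg]
  have hs : (Finsupp.single j a : LaurentV) = a • Finsupp.single j 1 := by simp
  rw [hs, map_smul, map_smul]
  congr 1
  ext i
  simpa using key (i - j)

/-- A polynomial with `q(x + 1) = q(x)` is constant. -/
theorem eq_C_of_comp_X_add_one_eq {q : ℂ[X]} (h : q.comp (X + C 1) = q) :
    q = C (q.eval 0) := by
  have hn : ∀ n : ℕ, q.eval (n : ℂ) = q.eval 0 := by
    intro n
    induction n with
    | zero => simp
    | succ n ih =>
      rw [← ih]
      conv_rhs => rw [← h]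
      simp
  refine eq_of_infinite_eval_eq _ _ ?_
  refine (Set.infinite_range_of_injective (Nat.cast_injective (R := ℂ))).mono ?_
  rintro _ ⟨n, rfl⟩
  simp [hn n]

/-- The shape of a family of involutions `S k` of `ℂ[x]` which is antimultiplicative for the
product transported from `𝒟ᵃ_p` through `t^k f(D) p(D) ↔ (k, f)`. -/
theorem exists_eq_C_mul_comp_of_antimultiplicative {p : ℂ[X]} (hp : p ≠ 0)
    (S : ℤ → ℂ[X] → ℂ[X])
    (hadd : ∀ f g, S 0 (f + g) = S 0 f + S 0 g)
    (hC : ∀ z f, S 0 (C z * f) = C z * S 0 f)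
    (hinv : ∀ k f, S k (S k f) = f)
    (hmul : ∀ k l f g, S (k + l) ((f * p).comp (X + C (l : ℂ)) * g) =
      (S l g * p).comp (X + C (k : ℂ)) * S k f) :
    ∃ (c : ℂ) (ε : ℤ → ℂ), (∀ k, ε k = 1 ∨ ε k = -1) ∧
      ∀ k f, S k f = C (ε k) * f.comp (C (c - (k : ℂ)) - X) := by
  have hshift : ∀ (r : ℂ), p.comp (X + C r) ≠ 0 := fun r hr => hp <| by
    have := congrArg (fun u : ℂ[X] => u.comp (X - C r)) hr
    simpa [comp_assoc] using this
  have hR : ∀ k f g, S k (f * p * g) = (S 0 g * p).comp (X + C (k : ℂ)) * S k f := by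
    intro k f g
    simpa using hmul k 0 f g
  have hL : ∀ k f g, S k ((f * p).comp (X + C (k : ℂ)) * g) = S k g * p * S 0 f := by
    intro k f g
    simpa using hmul 0 k f g
  have hsymm : ∀ (k : ℤ) (f g : ℂ[X]), (S 0 g).comp (X + C (k : ℂ)) * S k f =
      (S 0 f).comp (X + C (k : ℂ)) * S k g := by
    intro k f g
    refine mul_left_cancel₀ (hshift k) ?_
    have h := hR k f g
    rw [show f * p * g = g * p * f by ring, hR k g f] at h
    rw [mul_comp, mul_comp] at h
    linear_combination -h
  have hR1 : ∀ (k : ℤ) (f : ℂ[X]), (S 0 1).comp (X + C (k : ℂ)) * S k f =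
      (S 0 f).comp (X + C (k : ℂ)) * S k 1 := fun k f => hsymm k f 1
  have hS0 : ∀ f g, S 0 (f * g) * S 0 1 = S 0 f * S 0 g := by
    intro f g
    refine mul_left_cancel₀ hp ?_
    have h1 := hR 0 (f * g) 1
    have h2 := hR 0 f g
    rw [show f * g * p * 1 = f * p * g by ring, h2] at h1
    simp only [Int.cast_zero, C_0, add_zero, comp_X] at h1
    linear_combination -h1
  obtain ⟨a, ha⟩ : ∃ a : ℂ, S 0 1 = C a := by
    have hu : IsUnit (S 0 1) := by
      refine IsUnit.of_mul_eq_one (S 0 (S 0 1 * S 0 1)) ?_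
      rw [mul_comm, hS0, hinv, one_mul]
    obtain ⟨a, -, ha⟩ := isUnit_iff.mp hu
    exact ⟨a, ha.symm⟩
  have haa : a * a = 1 := by
    have h := hinv 0 1
    rw [ha, ← mul_one (C a), hC, ha, ← C_mul] at h
    exact C_injective (h.trans C_1.symm)
  have ha0 : a ≠ 0 := left_ne_zero_of_mul_eq_one haa
  have hCaa : C a * C a = 1 := by rw [← C_mul, haa, C_1]
  set q : ℂ[X] := C a * S 0 X with hq
  have hcomp : ∀ f, S 0 f = C a * f.comp q := by
    have hS0' : ∀ f g, S 0 (f * g) = C a * (S 0 f * S 0 g) := by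
      intro f g
      rw [← hS0, ha]
      linear_combination (-S 0 (f * g)) * hCaa
    intro f
    induction f using Polynomial.induction_on' with
    | add f g hf hg => rw [hadd, hf, hg, add_comp, mul_add]
    | monomial n z =>
      rw [← C_mul_X_pow_eq_monomial, hC]
      simp only [mul_comp, C_comp, pow_comp, X_comp]
      have hpow : S 0 (X ^ n) = C a * q ^ n := by
        induction n with
        | zero => simp [ha]
        | succ n ih =>
          rw [pow_succ, hS0', ih, hq]
          ring
      rw [hpow]
      ring
  have hSk : ∀ k f, S k f = S k 1 * f.comp (q.comp (X + C (k : ℂ))) := by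
    intro k f
    refine mul_left_cancel₀ (C_ne_zero.mpr ha0) ?_
    have h := hR1 k f
    rw [ha, C_comp, hcomp f, mul_comp, C_comp, comp_assoc] at h
    linear_combination h
  have hb : ∀ k, ∃ b : ℂ, S k 1 = C b := by
    intro k
    have hu : IsUnit (S k 1) := by
      refine IsUnit.of_mul_eq_one ((S k 1).comp (q.comp (X + C (k : ℂ)))) ?_
      rw [← hSk, hinv]
    obtain ⟨b, -, hb⟩ := isUnit_iff.mp hu
    exact ⟨b, hb.symm⟩
  choose b hb using hb
  have hbb : ∀ k, b k * b k = 1 := by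
    intro k
    have h := hinv k 1
    rw [hSk, hb, C_comp, ← C_mul] at h
    exact C_injective (h.trans C_1.symm)
  have hperiod : q.comp (X + C 1) + 1 = q := by
    have hL1 : ∀ f : ℂ[X], S 1 (f.comp (X + C 1)) = S 1 1 * f.comp q := by
      intro f
      have h := hL 1 f 1
      have h' := hL 1 1 (f.comp (X + C 1))
      simp only [Int.cast_one] at h h'
      rw [show ((1 : ℂ[X]) * p).comp (X + C 1) * f.comp (X + C 1)
        = (f * p).comp (X + C 1) * 1 by simp only [mul_comp, one_comp]; ring, h, ha,
        hcomp f] at h'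
      refine mul_left_cancel₀ hp (mul_left_cancel₀ (C_ne_zero.mpr ha0) ?_)
      linear_combination -h'
    have h := hL1 X
    rw [hSk, X_comp, X_comp, hb] at h
    have h' := mul_left_cancel₀ (C_ne_zero.mpr (left_ne_zero_of_mul_eq_one (hbb 1))) h
    simpa using h'
  have hconst := eq_C_of_comp_X_add_one_eq (q := q + X) (by
    rw [add_comp, X_comp, C_1]
    rw [C_1] at hperiod
    linear_combination hperiod)
  set c := (q + X).eval 0
  refine ⟨c, b, fun k => mul_self_eq_one_iff.mp (hbb k), fun k f => ?_⟩
  have hqc : q = C c - X := eq_sub_of_add_eq hconst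
  rw [hSk, hb, hqc, sub_comp, C_comp, X_comp, C_sub]
  congr 2
  ring

theorem sigma0_formula (p : Polynomial ℂ) (hp : p ≠ 0)
    (σ : ↥(Dp p) →ₗ[ℂ] ↥(Dp p)) (h1 : IsAntiInvolutionOn p σ) (h2 : PreservesGrading p σ)
    (σ₀ : ↥(Dp 1) → ↥(Dp 1))
    (hσ₀ : ∀ (A : ↥(Dp 1)) (Y : ↥(Dp p)),
      (Y : Module.End ℂ LaurentV) = (A : Module.End ℂ LaurentV) * op 0 p →
      ((σ Y : Module.End ℂ LaurentV)) = (σ₀ A : Module.End ℂ LaurentV) * op 0 p) :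
    ∃ (c : ℂ) (ε : ℤ → ℂ), (∀ k : ℤ, ε k = 1 ∨ ε k = -1) ∧
      ∀ (k : ℤ) (f : Polynomial ℂ) (A : ↥(Dp 1)),
        (A : Module.End ℂ LaurentV) = op k f →
        ((σ₀ A : Module.End ℂ LaurentV)) =
          ε k • op k (f.comp (Polynomial.C (c - (k : ℂ)) - Polynomial.X)) := by
  obtain ⟨hinv, hanti⟩ := h1
  have hex : ∀ (k : ℤ) (f : ℂ[X]), ∃ g : ℂ[X],
      (σ ⟨op k (f * p), op_mem_Dp p k f⟩ : Module.End ℂ LaurentV) = op k (g * p) := fun k f =>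
    exists_eq_op_of_mem_Dgrade (h2 k _ (Submodule.subset_span ⟨f, rfl⟩))
  choose S hS using hex
  have hS' : ∀ (k : ℤ) (f : ℂ[X]) (A : Dp p), (A : Module.End ℂ LaurentV) = op k (f * p) →
      (σ A : Module.End ℂ LaurentV) = op k (S k f * p) := by
    rintro k f ⟨A, hA⟩ rfl
    exact hS k f
  have hcancel : ∀ {k : ℤ} {f g : ℂ[X]}, op k (f * p) = op k (g * p) → f = g :=
    fun h => mul_right_cancel₀ hp (op_injective _ h)
  obtain ⟨c, ε, hε, hform⟩ := exists_eq_C_mul_comp_of_antimultiplicative hp S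
    (fun f g => hcancel (k := 0) (by
      rw [← hS' 0 (f + g) (⟨_, op_mem_Dp p 0 f⟩ + ⟨_, op_mem_Dp p 0 g⟩)
        (by simp [add_mul, op_add]), map_add, Submodule.coe_add, hS, hS, add_mul, op_add]))
    (fun z f => hcancel (k := 0) (by
      rw [← hS' 0 (C z * f) (z • ⟨_, op_mem_Dp p 0 f⟩)
        (by simp [mul_assoc, op_C_mul]), map_smul, Submodule.coe_smul, hS, mul_assoc, op_C_mul]))
    (fun k f => hcancel (k := k) (by
      rw [← hS' k (S k f) _ (hS k f), hinv]))
    (fun k l f g => hcancel (k := k + l) (by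
      have h := hanti ⟨_, op_mem_Dp p k f⟩ ⟨_, op_mem_Dp p l g⟩
        ⟨_, op_mem_Dp p (k + l) ((f * p).comp (X + C (l : ℂ)) * g)⟩
        (by simp only [op_mul_op, mul_assoc])
      rw [hS, hS, hS, op_mul_op, add_comm l k, ← mul_assoc] at h
      exact h))
  refine ⟨c, ε, hε, fun k f A hA => ?_⟩
  have hY := hσ₀ A ⟨_, op_mem_Dp p k f⟩ (by rw [hA, op_mul_op]; simp)
  rw [hS, hform] at hY
  rw [← op_C_mul]
  refine eq_of_mul_op_zero_eq hp (σ₀ A).2 (q := 1) ?_ ?_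
  · simpa using op_mem_Dp 1 k (C (ε k) * f.comp (C (c - (k : ℂ)) - X))
  · rw [← hY, op_mul_op]
    simp

end
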